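/- arXiv:math/0406372 — 2 statements merged into one kernel-verified Lean document; each statement's English description precedes it below -/
import Mathlib

section
/- Let a < b be real numbers, n ≥ 1 a natural number, and 1 ≤ p < ∞ a real number. Suppose f : ℝ → ℝ is such that for each k ≤ n+1 the k-th derivative f^{(k)} exists at every point of [a,b], and f^{(n+1)} is interval-integrable on [a,b]. Then ‖R_n‖_p ≤ ((b-a)^{n+1/p} / (n! · (np+1)^{1/p})) · ‖f^{(n+1)}‖, where the Alexiewicz norm is taken over [a,b]. -/
open MeasureTheory intervalIntegral

/-- The derivative of a Taylor polynomial with coefficients `c` is the Taylor polynomial with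
shifted coefficients. -/
theorem hasDerivAt_taylorSum (c : ℕ → ℝ) (a x : ℝ) (m : ℕ) :
    HasDerivAt (fun y => ∑ k ∈ Finset.range (m + 1), c k * (y - a) ^ k / (Nat.factorial k : ℝ))
      (∑ k ∈ Finset.range m, c (k + 1) * (x - a) ^ k / (Nat.factorial k : ℝ)) x := by
  simp only [Finset.sum_range_succ' _ m, pow_zero]
  refine HasDerivAt.add_const _ (HasDerivAt.fun_sum fun k _ => ?_)
  have h := ((((hasDerivAt_id x).sub_const a).fun_pow (k + 1)).const_mul (c (k + 1))).div_const
    (Nat.factorial (k + 1) : ℝ)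
  refine h.congr_deriv ?_
  have hk : (Nat.factorial k : ℝ) ≠ 0 := by positivity
  have hk' : (k : ℝ) + 1 ≠ 0 := by positivity
  simp only [Nat.factorial_succ, id, Nat.add_sub_cancel]
  push_cast
  field_simp

/-- Taylor remainder bound for a chain of successive derivatives `F 0, …, F m`, in terms of the
oscillation of the last one about `a`. -/
theorem abs_taylor_remainder_le {a b M : ℝ} (m : ℕ) (F : ℕ → ℝ → ℝ)
    (hF : ∀ k < m, ∀ x ∈ Set.Icc a b, HasDerivAt (F k) (F (k + 1) x) x)
    (hM : ∀ x ∈ Set.Icc a b, |F m x - F m a| ≤ M) :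
    ∀ x ∈ Set.Icc a b,
      |F 0 x - ∑ k ∈ Finset.range (m + 1), F k a * (x - a) ^ k / (Nat.factorial k : ℝ)| ≤
        M / (Nat.factorial m : ℝ) * (x - a) ^ m := by
  induction m generalizing F with
  | zero => simpa using hM
  | succ m ih =>
    have hbound := ih (fun k => F (k + 1)) (fun k hk => hF (k + 1) (by omega)) hM
    have hderiv : ∀ x ∈ Set.Icc a b, HasDerivAt
        (fun y => F 0 y - ∑ k ∈ Finset.range (m + 2),
          F k a * (y - a) ^ k / (Nat.factorial k : ℝ))
        (F 1 x - ∑ k ∈ Finset.range (m + 1),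
          F (k + 1) a * (x - a) ^ k / (Nat.factorial k : ℝ)) x := fun x hx =>
      (hF 0 (by omega) x hx).fun_sub (hasDerivAt_taylorSum (fun k => F k a) a x (m + 1))
    refine image_norm_le_of_norm_deriv_right_le_deriv_boundary
      (B' := fun x => M / (Nat.factorial m : ℝ) * (x - a) ^ m)
      (fun x hx => (hderiv x hx).continuousAt.continuousWithinAt)
      (fun x hx => (hderiv x (Set.Ico_subset_Icc_self hx)).hasDerivWithinAt) ?_ ?_
      (fun x hx => hbound x (Set.Ico_subset_Icc_self hx))
    · simp [Finset.sum_range_succ']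
    · intro x
      have h := (((hasDerivAt_id x).sub_const a).fun_pow (m + 1)).const_mul
        (M / (Nat.factorial (m + 1) : ℝ))
      refine h.congr_deriv ?_
      have hm : (Nat.factorial m : ℝ) ≠ 0 := by positivity
      have hm' : (m : ℝ) + 1 ≠ 0 := by positivity
      simp only [Nat.factorial_succ, id, Nat.add_sub_cancel]
      push_cast
      field_simp

/-- A pointwise bound by `C * (x - a) ^ n` gives the corresponding `L^p` bound on `[a, b]`. -/
theorem integral_abs_rpow_le_of_abs_le_mul_pow {a b C p : ℝ} (hab : a < b) (hp : 1 ≤ p)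
    (hC : 0 ≤ C) (n : ℕ) {g : ℝ → ℝ} (hg : ContinuousOn g (Set.Icc a b))
    (hbound : ∀ x ∈ Set.Icc a b, |g x| ≤ C * (x - a) ^ n) :
    (∫ x in a..b, |g x| ^ p) ^ (1 / p) ≤
      (b - a) ^ ((n : ℝ) + 1 / p) / ((n : ℝ) * p + 1) ^ (1 / p) * C := by
  have hp0 : 0 < p := by linarith
  have hba : 0 < b - a := sub_pos.2 hab
  have hnp : 0 ≤ (n : ℝ) * p := by positivity
  have hint : ∫ x in a..b, C ^ p * (x - a) ^ ((n : ℝ) * p) =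
      C ^ p * ((b - a) ^ ((n : ℝ) * p + 1) / ((n : ℝ) * p + 1)) := by
    rw [intervalIntegral.integral_const_mul,
      integral_comp_sub_right (fun x => x ^ ((n : ℝ) * p)),
      integral_rpow (Or.inl (by linarith)), sub_self, Real.zero_rpow (by positivity), sub_zero]
  have hle : ∫ x in a..b, |g x| ^ p ≤ ∫ x in a..b, C ^ p * (x - a) ^ ((n : ℝ) * p) := by
    refine integral_mono_on hab.le ?_ ?_ fun x hx => ?_
    · refine ContinuousOn.intervalIntegrable ?_
      rw [Set.uIcc_of_le hab.le]
      exact hg.abs.rpow_const fun _ _ => Or.inr hp0.le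
    · exact (continuous_const.mul ((continuous_id.sub continuous_const).rpow_const
        fun _ => Or.inr hnp)).intervalIntegrable _ _
    · have hx0 : 0 ≤ x - a := sub_nonneg.2 hx.1
      calc |g x| ^ p ≤ (C * (x - a) ^ n) ^ p :=
            Real.rpow_le_rpow (abs_nonneg _) (hbound x hx) hp0.le
        _ = C ^ p * (x - a) ^ ((n : ℝ) * p) := by
            rw [Real.mul_rpow hC (by positivity), Real.rpow_mul hx0, Real.rpow_natCast]
  have hexp : ((n : ℝ) * p + 1) * (1 / p) = (n : ℝ) + 1 / p := by field_simp
  calc (∫ x in a..b, |g x| ^ p) ^ (1 / p)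
      ≤ (C ^ p * ((b - a) ^ ((n : ℝ) * p + 1) / ((n : ℝ) * p + 1))) ^ (1 / p) :=
        Real.rpow_le_rpow (integral_nonneg hab.le fun x _ => by positivity)
          (hle.trans_eq hint) (by positivity)
    _ = (b - a) ^ ((n : ℝ) + 1 / p) / ((n : ℝ) * p + 1) ^ (1 / p) * C := by
        rw [Real.mul_rpow (by positivity) (by positivity),
          Real.div_rpow (by positivity) (by positivity), ← Real.rpow_mul hC,
          ← Real.rpow_mul hba.le, hexp, mul_one_div_cancel hp0.ne', Real.rpow_one, mul_comm]

/-- `L^p`-norm estimate of the Taylor remainder `R_n` in terms of the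
Alexiewicz norm of `f⁽ⁿ⁺¹⁾`. -/
theorem taylor_remainder_Lp_estimate
    (a b : ℝ) (hab : a < b) (n : ℕ) (hn : 1 ≤ n) (p : ℝ) (hp : 1 ≤ p)
    (f : ℝ → ℝ)
    (hderiv : ∀ k < n + 1, ∀ x ∈ Set.Icc a b,
      HasDerivAt (iteratedDeriv k f) (iteratedDeriv (k + 1) f x) x)
    (hint : IntervalIntegrable (iteratedDeriv (n + 1) f) volume a b) :
    (∫ x in a..b,
        |f x - ∑ k ∈ Finset.range (n + 1),
          iteratedDeriv k f a * (x - a) ^ k / (Nat.factorial k : ℝ)| ^ p)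
      ^ (1 / p) ≤
      ((b - a) ^ ((n : ℝ) + 1 / p) /
        ((Nat.factorial n : ℝ) * ((n : ℝ) * p + 1) ^ (1 / p))) *
        ⨆ c : Set.Icc a b, |∫ t in a..(c : ℝ), iteratedDeriv (n + 1) f t| := by
  have hcont : ∀ k < n + 1, ContinuousOn (iteratedDeriv k f) (Set.Icc a b) := fun k hk x hx =>
    (hderiv k hk x hx).continuousAt.continuousWithinAt
  have hftc : ∀ x ∈ Set.Icc a b, ∫ t in a..x, iteratedDeriv (n + 1) f t =
      iteratedDeriv n f x - iteratedDeriv n f a := fun x hx => by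
    have hsub : Set.uIcc a x ⊆ Set.Icc a b := by
      rw [Set.uIcc_of_le hx.1]
      exact Set.Icc_subset_Icc_right hx.2
    exact integral_eq_sub_of_hasDerivAt (fun t ht => hderiv n n.lt_succ_self t (hsub ht))
      (hint.mono_set (by rwa [Set.uIcc_of_le hab.le]))
  set M := ⨆ c : Set.Icc a b, |∫ t in a..(c : ℝ), iteratedDeriv (n + 1) f t|
  have hbdd : BddAbove (Set.range fun c : Set.Icc a b =>
      |∫ t in a..(c : ℝ), iteratedDeriv (n + 1) f t|) := by
    obtain ⟨K, hK⟩ := isCompact_Icc.bddAbove_image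
      ((hcont n n.lt_succ_self).sub (continuousOn_const (c := iteratedDeriv n f a))).abs
    refine ⟨K, ?_⟩
    rintro _ ⟨c, rfl⟩
    simp only [hftc c c.2]
    exact hK (Set.mem_image_of_mem _ c.2)
  have hM : ∀ x ∈ Set.Icc a b, |iteratedDeriv n f x - iteratedDeriv n f a| ≤ M := fun x hx => by
    rw [← hftc x hx]
    exact le_ciSup hbdd ⟨x, hx⟩
  have hM0 : 0 ≤ M := Real.iSup_nonneg fun _ => abs_nonneg _
  have hrem := abs_taylor_remainder_le n (fun k => iteratedDeriv k f)
    (fun k hk => hderiv k (by omega)) hM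
  simp only [iteratedDeriv_zero] at hrem
  have hf : ContinuousOn f (Set.Icc a b) := by simpa using hcont 0 n.succ_pos
  refine (integral_abs_rpow_le_of_abs_le_mul_pow hab hp (by positivity) n
    (hf.sub (Continuous.continuousOn (by fun_prop))) hrem).trans_eq ?_
  field_simp
end

section
/- Let a < b be real numbers and n ≥ 1 a natural number. Suppose f : ℝ → ℝ is such that for each k ≤ n the k-th derivative f^{(k)} exists at every point of [a,b], and f^{(n)} is continuous on [a,b]. Then ‖R_n‖ = sup_{a ≤ y ≤ b} |∫_a^y R_n(x) dx| ≤ ((b-a)^{n+1} / (n+1)!) · max_{a ≤ x ≤ b} |f^{(n)}(x) - f^{(n)}(a)|. (No integrability or existence assumption is made on f^{(n+1)}; this is the Alexiewicz-norm estimate of the remainder when f^{(n+1)} exists only as a Schwartz distribution of order 1.) -/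
open MeasureTheory intervalIntegral

/-- The derivative of `c (y - a) ^ (n + 1) / (n + 1)!` is `c (y - a) ^ n / n!`. -/
theorem hasDerivAt_taylor_monomial_succ (c a x : ℝ) (n : ℕ) :
    HasDerivAt (fun y => c * (y - a) ^ (n + 1) / (Nat.factorial (n + 1) : ℝ))
      (c * (x - a) ^ n / (Nat.factorial n : ℝ)) x := by
  refine (((((hasDerivAt_id' x).sub_const a).fun_pow (n + 1)).const_mul c).div_const
    (Nat.factorial (n + 1) : ℝ)).congr_deriv ?_
  have hn : (n : ℝ) + 1 ≠ 0 := by positivity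
  simp only [Nat.factorial_succ, Nat.add_sub_cancel]
  push_cast
  field_simp

/-- The derivative of a Taylor polynomial with coefficients `c k / k!` is the Taylor polynomial of
one degree less with shifted coefficients. -/
theorem hasDerivAt_sum_taylor_monomials (c : ℕ → ℝ) (a x : ℝ) (n : ℕ) :
    HasDerivAt (fun y => ∑ k ∈ Finset.range (n + 1), c k * (y - a) ^ k / (Nat.factorial k : ℝ))
      (∑ k ∈ Finset.range n, c (k + 1) * (x - a) ^ k / (Nat.factorial k : ℝ)) x := by
  simp_rw [Finset.sum_range_succ' _ n]
  have hsum : HasDerivAt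
      (fun y => ∑ k ∈ Finset.range n,
        c (k + 1) * (y - a) ^ (k + 1) / (Nat.factorial (k + 1) : ℝ))
      (∑ k ∈ Finset.range n, c (k + 1) * (x - a) ^ k / (Nat.factorial k : ℝ)) x :=
    HasDerivAt.fun_sum fun k _ => hasDerivAt_taylor_monomial_succ (c (k + 1)) a x k
  simpa using hsum.add_const (c 0 * (1 : ℝ))

/-- If `g 0, g 1, …, g n` are successive derivatives on `[a, b]` and `g n` stays within `M` of its
value at `a`, then the Taylor remainder of order `n` is at most `M (x - a) ^ n / n!`. -/
theorem abs_taylor_remainder_le_of_abs_sub_le {a b M : ℝ} (n : ℕ) (g : ℕ → ℝ → ℝ)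
    (hderiv : ∀ k < n, ∀ x ∈ Set.Icc a b, HasDerivAt (g k) (g (k + 1) x) x)
    (hM : ∀ x ∈ Set.Icc a b, |g n x - g n a| ≤ M) :
    ∀ x ∈ Set.Icc a b,
      |g 0 x - ∑ k ∈ Finset.range (n + 1), g k a * (x - a) ^ k / (Nat.factorial k : ℝ)| ≤
        M * (x - a) ^ n / (Nat.factorial n : ℝ) := by
  induction n generalizing g with
  | zero => simpa using hM
  | succ n ih =>
    have hshift := ih (fun k => g (k + 1)) (fun k hk => hderiv (k + 1) (by omega)) hM
    have hrem : ∀ x ∈ Set.Icc a b, HasDerivAt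
        (fun y => g 0 y -
          ∑ k ∈ Finset.range (n + 1 + 1), g k a * (y - a) ^ k / (Nat.factorial k : ℝ))
        (g 1 x - ∑ k ∈ Finset.range (n + 1), g (k + 1) a * (x - a) ^ k / (Nat.factorial k : ℝ))
        x := fun x hx =>
      (hderiv 0 (by omega) x hx).sub
        (hasDerivAt_sum_taylor_monomials (fun k => g k a) a x (n + 1))
    intro x hx
    refine image_norm_le_of_norm_deriv_right_le_deriv_boundary
      (fun y hy => (hrem y hy).continuousAt.continuousWithinAt)
      (fun y hy => (hrem y (Set.Ico_subset_Icc_self hy)).hasDerivWithinAt) ?_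
      (fun y => hasDerivAt_taylor_monomial_succ M a y n)
      (fun y hy => hshift y (Set.Ico_subset_Icc_self hy)) hx
    simp [Finset.sum_range_succ']

/-- Alexiewicz-norm estimate of the Taylor remainder when `f⁽ⁿ⁾` is merely
continuous on `[a,b]` (distributional derivative case). -/
theorem taylor_remainder_alexiewicz_continuous_estimate
    (a b : ℝ) (hab : a < b) (n : ℕ) (hn : 1 ≤ n) (f : ℝ → ℝ)
    (hderiv : ∀ k < n, ∀ x ∈ Set.Icc a b,
      HasDerivAt (iteratedDeriv k f) (iteratedDeriv (k + 1) f x) x)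
    (hcont : ContinuousOn (iteratedDeriv n f) (Set.Icc a b)) :
    (⨆ y : Set.Icc a b, |∫ x in a..(y : ℝ),
        (f x - ∑ k ∈ Finset.range (n + 1),
          iteratedDeriv k f a * (x - a) ^ k / (Nat.factorial k : ℝ))|) ≤
      ((b - a) ^ (n + 1) / (Nat.factorial (n + 1) : ℝ)) *
        ⨆ x : Set.Icc a b, |iteratedDeriv n f (x : ℝ) - iteratedDeriv n f a| := by
  set M := ⨆ x : Set.Icc a b, |iteratedDeriv n f (x : ℝ) - iteratedDeriv n f a|
  have hbdd : BddAbove (Set.range fun x : Set.Icc a b =>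
      |iteratedDeriv n f (x : ℝ) - iteratedDeriv n f a|) :=
    (isCompact_range (hcont.domRestrict.sub continuous_const).abs).bddAbove
  have hM : ∀ x ∈ Set.Icc a b, |iteratedDeriv n f x - iteratedDeriv n f a| ≤ M :=
    fun x hx => le_ciSup hbdd ⟨x, hx⟩
  have hM0 : 0 ≤ M := Real.iSup_nonneg fun _ => abs_nonneg _
  have hrem := abs_taylor_remainder_le_of_abs_sub_le n (fun k => iteratedDeriv k f) hderiv hM
  simp only [iteratedDeriv_zero] at hrem
  have : Nonempty (Set.Icc a b) := ⟨⟨a, Set.left_mem_Icc.2 hab.le⟩⟩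
  have hint : Continuous fun x => M * (x - a) ^ n / (Nat.factorial n : ℝ) := by fun_prop
  refine ciSup_le fun ⟨y, hay, hyb⟩ => ?_
  calc |∫ x in a..y, (f x - ∑ k ∈ Finset.range (n + 1),
          iteratedDeriv k f a * (x - a) ^ k / (Nat.factorial k : ℝ))|
      ≤ ∫ x in a..y, M * (x - a) ^ n / (Nat.factorial n : ℝ) := by
        rw [← Real.norm_eq_abs]
        exact norm_integral_le_of_norm_le hay
          (Filter.Eventually.of_forall fun x hx => hrem x ⟨hx.1.le, hx.2.trans hyb⟩)
          (hint.intervalIntegrable _ _)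
    _ = (y - a) ^ (n + 1) / (Nat.factorial (n + 1) : ℝ) * M := by
        rw [intervalIntegral.integral_div, intervalIntegral.integral_const_mul,
          intervalIntegral.integral_comp_sub_right (fun x => x ^ n), integral_pow]
        have hn' : (n : ℝ) + 1 ≠ 0 := by positivity
        simp only [Nat.factorial_succ, sub_self]
        push_cast
        field_simp
        ring
    _ ≤ (b - a) ^ (n + 1) / (Nat.factorial (n + 1) : ℝ) * M := by
        have hya : 0 ≤ y - a := sub_nonneg.2 hay
        gcongr
end
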